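/- arXiv:1301.5309 — 2 statements merged into one kernel-verified Lean document; each statement's English description precedes it below -/
import Mathlib

section
/- (Per-time-step entropy leakage inequality.) Let X : Ω → ZMod 2 and Z' : Ω → S' be measurable random variables with S' a finite type, let Z = f ∘ Z' for a measurable function f : S' → S into a finite type S (so Z is a coarsening of Z'), and let G₁, G₂ : Ω → Bool be independent Bernoulli(p)-distributed random variables with the pair (G₁, G₂) independent of the pair ⟨X, Z'⟩. Then (2−p) · H(G₂·X | ⟨Z, G₁, G₂⟩) ≥ H(⟨G₁·X, G₂·X⟩ | ⟨Z', G₁, G₂⟩). -/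
open MeasureTheory ProbabilityTheory

/-- Shannon entropy (natural logarithm) of a finitely-valued random variable. -/
noncomputable def entropy {Ω : Type*} [MeasurableSpace Ω] (μ : Measure Ω)
    {S : Type*} [Fintype S] (X : Ω → S) : ℝ :=
  ∑ s : S, Real.negMulLog (μ (X ⁻¹' {s})).toReal

/-- Conditional Shannon entropy `H(X | Y) = H(⟨X, Y⟩) - H(Y)` of finitely-valued
random variables (natural logarithm). -/
noncomputable def condEntropy {Ω : Type*} [MeasurableSpace Ω] (μ : Measure Ω)
    {S T : Type*} [Fintype S] [Fintype T] (X : Ω → S) (Y : Ω → T) : ℝ :=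
  entropy μ (fun ω => (X ω, Y ω)) - entropy μ Y

/-- Conditional mutual information `I(X : Y | Z)` of finitely-valued random variables. -/
noncomputable def condMutualInfo {Ω : Type*} [MeasurableSpace Ω] (μ : Measure Ω)
    {S T U : Type*} [Fintype S] [Fintype T] [Fintype U]
    (X : Ω → S) (Y : Ω → T) (Z : Ω → U) : ℝ :=
  condEntropy μ X Z + condEntropy μ Y Z - condEntropy μ (fun ω => (X ω, Y ω)) Z

/-- The masked variable `G·X`, equal to `X` where `G = true` and `0` where `G = false`. -/
def mask {Ω : Type*} (G : Ω → Bool) (X : Ω → ZMod 2) : Ω → ZMod 2 :=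
  fun ω => if G ω then X ω else 0

section EntropyLemmas

variable {Ω : Type*} [MeasurableSpace Ω] {μ : Measure Ω} [IsProbabilityMeasure μ]
variable {S : Type*} [Fintype S] [MeasurableSpace S] [MeasurableSingletonClass S]

lemma sum_measureReal_fiber_eq_one {Y : Ω → S} (hY : Measurable Y) :
    ∑ y, μ.real (Y ⁻¹' {y}) = 1 := by
  rw [sum_measureReal_preimage_singleton _ fun y _ => hY (measurableSet_singleton y)]
  simp

lemma sum_measureReal_fiber_of_comp {T : Type*} [DecidableEq T] {Y : Ω → S} (hY : Measurable Y)
    (g : S → T) (t : T) :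
    ∑ y with g y = t, μ.real (Y ⁻¹' {y}) = μ.real ((fun ω => g (Y ω)) ⁻¹' {t}) := by
  rw [sum_measureReal_preimage_singleton _ fun y _ => hY (measurableSet_singleton y)]
  congr 1
  ext ω
  simp

lemma entropy_comp_eq_neg_sum {T : Type*} [Fintype T] {Y : Ω → S} (hY : Measurable Y)
    (g : S → T) :
    entropy μ (fun ω => g (Y ω))
      = -∑ y, μ.real (Y ⁻¹' {y}) * Real.log (μ.real ((fun ω => g (Y ω)) ⁻¹' {g y})) := by
  classical
  rw [← Finset.sum_fiberwise _ g, ← Finset.sum_neg_distrib]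
  refine Finset.sum_congr rfl fun t _ => ?_
  rw [← measureReal_def, Real.negMulLog, neg_mul]
  congr 1
  nth_rewrite 1 [← sum_measureReal_fiber_of_comp hY g t]
  rw [Finset.sum_mul]
  refine Finset.sum_congr rfl fun y hy => ?_
  rw [(Finset.mem_filter.1 hy).2]

lemma entropy_comp_injective {T : Type*} [Fintype T] {Y : Ω → S} (hY : Measurable Y)
    {g : S → T} (hg : Function.Injective g) :
    entropy μ (fun ω => g (Y ω)) = entropy μ Y := by
  rw [entropy_comp_eq_neg_sum hY g, entropy_comp_eq_neg_sum hY fun y => y]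
  congr 1
  refine Finset.sum_congr rfl fun y _ => ?_
  congr 3
  ext ω
  simp [hg.eq_iff]

lemma condEntropy_comp_injective {T U : Type*} [Fintype T] [Fintype U] [MeasurableSpace U]
    [MeasurableSingletonClass U] {X : Ω → S} (hX : Measurable X) {W : Ω → U} (hW : Measurable W)
    {g : S → T} (hg : Function.Injective g) :
    condEntropy μ (fun ω => g (X ω)) W = condEntropy μ X W := by
  have hinj : Function.Injective fun z : S × U => (g z.1, z.2) := fun _ _ h =>
    Prod.ext (hg (Prod.mk.inj h).1) (Prod.mk.inj h).2
  have h := entropy_comp_injective (μ := μ) (hX.prodMk hW) hinj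
  unfold condEntropy
  rw [h]

lemma condEntropy_const {T : Type*} [Fintype T] {W : Ω → S} (hW : Measurable W) (c : T) :
    condEntropy μ (fun _ => c) W = 0 :=
  sub_eq_zero.2 <| entropy_comp_injective hW (Prod.mk_right_injective c)

/-- Coarsening the conditioning variable does not decrease conditional entropy. -/
lemma condEntropy_le_condEntropy_comp {T U : Type*} [Fintype T] [Fintype U] [MeasurableSpace U]
    [MeasurableSingletonClass U] {X : Ω → U} (hX : Measurable X) {W : Ω → S} (hW : Measurable W)
    (f : S → T) :
    condEntropy μ X W ≤ condEntropy μ X (fun ω => f (W ω)) := by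
  classical
  have hY : Measurable fun ω => (X ω, W ω) := hX.prodMk hW
  set r : U × S → ℝ := fun y => μ.real ((fun ω => (X ω, W ω)) ⁻¹' {y}) with hr
  set q : S → ℝ := fun s => μ.real (W ⁻¹' {s}) with hq
  set Q : T → ℝ := fun t => μ.real ((fun ω => f (W ω)) ⁻¹' {t}) with hQ
  set A : U × T → ℝ := fun y => μ.real ((fun ω => (X ω, f (W ω))) ⁻¹' {y}) with hA
  have hXW : entropy μ (fun ω => (X ω, W ω)) = -∑ y, r y * Real.log (r y) :=
    entropy_comp_eq_neg_sum hY fun y => y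
  have hWe : entropy μ W = -∑ y, r y * Real.log (q y.2) := entropy_comp_eq_neg_sum hY Prod.snd
  have hXf : entropy μ (fun ω => (X ω, f (W ω))) = -∑ y, r y * Real.log (A (y.1, f y.2)) :=
    entropy_comp_eq_neg_sum hY fun y => (y.1, f y.2)
  have hfe : entropy μ (fun ω => f (W ω)) = -∑ y, r y * Real.log (Q (f y.2)) :=
    entropy_comp_eq_neg_sum hY fun y => f y.2
  have hterm : ∀ y : U × S, r y * Real.log (q y.2) - r y * Real.log (r y)
      + r y * Real.log (A (y.1, f y.2)) - r y * Real.log (Q (f y.2))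
      ≤ A (y.1, f y.2) * q y.2 / Q (f y.2) - r y := by
    intro y
    have hrq : r y ≤ q y.2 := measureReal_mono fun ω hω => congrArg Prod.snd hω
    have hrA : r y ≤ A (y.1, f y.2) :=
      measureReal_mono fun ω hω => congrArg (fun z : U × S => (z.1, f z.2)) hω
    have hrQ : r y ≤ Q (f y.2) :=
      measureReal_mono fun ω hω => congrArg (fun z : U × S => f z.2) hω
    have hr0 : 0 ≤ r y := measureReal_nonneg
    rcases hr0.eq_or_lt with h0 | h0
    · rw [← h0] at hrq hrA hrQ ⊢
      simpa using div_nonneg (mul_nonneg hrA hrq) hrQ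
    · have hq0 := h0.trans_le hrq
      have hA0 := h0.trans_le hrA
      have hQ0 := h0.trans_le hrQ
      have hlog := Real.log_le_sub_one_of_pos
        (show 0 < A (y.1, f y.2) * q y.2 / (Q (f y.2) * r y) by positivity)
      rw [Real.log_div (by positivity) (by positivity), Real.log_mul hA0.ne' hq0.ne',
        Real.log_mul hQ0.ne' h0.ne'] at hlog
      have hmul := mul_le_mul_of_nonneg_left hlog hr0
      have heq : r y * (A (y.1, f y.2) * q y.2 / (Q (f y.2) * r y) - 1)
          = A (y.1, f y.2) * q y.2 / Q (f y.2) - r y := by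
        field_simp
      linarith
  have hr1 : ∑ y, r y = 1 := sum_measureReal_fiber_eq_one hY
  have hAQ : ∀ t, ∑ x, A (x, t) = Q t := by
    intro t
    have hsum := sum_measureReal_preimage_singleton (μ := μ.restrict (W ⁻¹' (f ⁻¹' {t})))
      Finset.univ (f := X) fun x _ => hX (measurableSet_singleton x)
    simp only [Finset.coe_univ, Set.preimage_univ, measureReal_restrict_apply MeasurableSet.univ,
      Set.univ_inter] at hsum
    refine Eq.trans (Finset.sum_congr rfl fun x _ => ?_) hsum
    rw [measureReal_restrict_apply (hX (measurableSet_singleton x))]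
    refine congrArg μ.real ?_
    ext ω
    simp
  have hbound : ∑ y : U × S, A (y.1, f y.2) * q y.2 / Q (f y.2) ≤ 1 := by
    rw [Fintype.sum_prod_type_right, ← sum_measureReal_fiber_eq_one (μ := μ) hW]
    refine Finset.sum_le_sum fun s _ => ?_
    simp only [mul_div_assoc]
    rw [← Finset.sum_mul, hAQ, mul_div_left_comm]
    exact mul_le_of_le_one_right measureReal_nonneg (div_self_le_one _)
  have hsum := Finset.sum_le_sum fun y (_ : y ∈ Finset.univ) => hterm y
  simp only [Finset.sum_sub_distrib, Finset.sum_add_distrib] at hsum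
  unfold condEntropy
  linarith

/-- Chain rule for a mixture whose selector is independent of the mixed variable. -/
lemma entropy_mixture {Γ T : Type*} [Fintype Γ] [MeasurableSpace Γ]
    [MeasurableSingletonClass Γ] [Fintype T] {V : Ω → S} (hV : Measurable V) {G : Ω → Γ}
    (h : IndepFun G V μ) (ψ : Γ → S → T) :
    entropy μ (fun ω => (ψ (G ω) (V ω), G ω))
      = (∑ g, Real.negMulLog (μ.real (G ⁻¹' {g})))
        + ∑ g, μ.real (G ⁻¹' {g}) * entropy μ (fun ω => ψ g (V ω)) := by
  classical
  have hprod : ∀ g t, μ.real ((fun ω => (ψ (G ω) (V ω), G ω)) ⁻¹' {(t, g)})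
      = μ.real (G ⁻¹' {g}) * μ.real ((fun ω => ψ g (V ω)) ⁻¹' {t}) := by
    intro g t
    have hset : (fun ω => (ψ (G ω) (V ω), G ω)) ⁻¹' {(t, g)}
        = G ⁻¹' {g} ∩ V ⁻¹' (ψ g ⁻¹' {t}) := by
      ext ω
      simp only [Set.mem_preimage, Set.mem_singleton_iff, Prod.mk.injEq, Set.mem_inter_iff]
      constructor
      · rintro ⟨h1, rfl⟩
        exact ⟨rfl, h1⟩
      · rintro ⟨rfl, h1⟩
        exact ⟨h1, rfl⟩
    rw [hset, measureReal_def, h.measure_inter_preimage_eq_mul _ _ (measurableSet_singleton g)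
      (Set.toFinite _).measurableSet, ENNReal.toReal_mul]
    rfl
  have hone : ∀ g, ∑ t, μ.real ((fun ω => ψ g (V ω)) ⁻¹' {t}) = 1 := by
    intro g
    simp_rw [← sum_measureReal_fiber_of_comp hV (ψ g)]
    exact (Finset.sum_fiberwise _ (ψ g) _).trans (sum_measureReal_fiber_eq_one hV)
  unfold entropy
  simp only [← measureReal_def]
  rw [Fintype.sum_prod_type_right, ← Finset.sum_add_distrib]
  refine Finset.sum_congr rfl fun g _ => ?_
  simp only [hprod, Real.negMulLog_mul]
  rw [Finset.sum_add_distrib, ← Finset.sum_mul, hone, one_mul, ← Finset.mul_sum]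

lemma condEntropy_mixture {Γ T U : Type*} [Fintype Γ] [MeasurableSpace Γ]
    [MeasurableSingletonClass Γ] [Fintype T] [Fintype U] [MeasurableSpace U]
    [MeasurableSingletonClass U] {X : Ω → S} (hX : Measurable X) {W : Ω → U}
    (hW : Measurable W) {G : Ω → Γ} (hG : Measurable G)
    (h : IndepFun G (fun ω => (X ω, W ω)) μ) (φ : Γ → S → T) :
    condEntropy μ (fun ω => φ (G ω) (X ω)) (fun ω => (W ω, G ω))
      = ∑ g, μ.real (G ⁻¹' {g}) * condEntropy μ (fun ω => φ g (X ω)) W := by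
  have hXW := hX.prodMk hW
  let _ : MeasurableSpace T := ⊤
  have hφ : Measurable fun ω => φ (G ω) (X ω) :=
    (measurable_of_finite fun z : Γ × S => φ z.1 z.2).comp (hG.prodMk hX)
  have hassoc : entropy μ (fun ω => (φ (G ω) (X ω), W ω, G ω))
      = entropy μ (fun ω => ((φ (G ω) (X ω), W ω), G ω)) :=
    entropy_comp_injective (g := fun z : (T × U) × Γ => (z.1.1, z.1.2, z.2))
      ((hφ.prodMk hW).prodMk hG) (Equiv.prodAssoc T U Γ).injective
  have hnum := entropy_mixture hXW h fun g z => (φ g z.1, z.2)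
  have hden := entropy_mixture hXW h fun _ z => z.2
  unfold condEntropy
  rw [hassoc, hnum, hden]
  simp only [mul_sub, Finset.sum_sub_distrib]
  ring

end EntropyLemmas

/-- **Per-time-step entropy leakage inequality.** With `Z = f ∘ Z'` a coarsening of `Z'`,
and `G₁, G₂` independent Bernoulli(`p`) random variables whose pair is independent of
`⟨X, Z'⟩`, one has `(2−p) · H(G₂·X | ⟨Z, G₁, G₂⟩) ≥ H(⟨G₁·X, G₂·X⟩ | ⟨Z', G₁, G₂⟩)`. -/
theorem stmt_4 {Ω : Type*} [MeasurableSpace Ω] (μ : Measure Ω) [IsProbabilityMeasure μ]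
    {S S' : Type*} [Fintype S] [MeasurableSpace S] [MeasurableSingletonClass S]
    [Fintype S'] [MeasurableSpace S'] [MeasurableSingletonClass S']
    (X : Ω → ZMod 2) (Z' : Ω → S') (f : S' → S) (G₁ G₂ : Ω → Bool) (p : ℝ)
    (hX : Measurable X) (hZ' : Measurable Z') (hf : Measurable f)
    (hG₁ : Measurable G₁) (hG₂ : Measurable G₂)
    (hp : p ∈ Set.Icc (0 : ℝ) 1)
    (hBer₁ : μ (G₁ ⁻¹' {true}) = ENNReal.ofReal p)
    (hBer₂ : μ (G₂ ⁻¹' {true}) = ENNReal.ofReal p)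
    (hG₁G₂ : IndepFun G₁ G₂ μ)
    (hindep : IndepFun (fun ω => (G₁ ω, G₂ ω)) (fun ω => (X ω, Z' ω)) μ) :
    (2 - p) * condEntropy μ (mask G₂ X) (fun ω => (f (Z' ω), G₁ ω, G₂ ω))
      ≥ condEntropy μ (fun ω => (mask G₁ X ω, mask G₂ X ω))
          (fun ω => (Z' ω, G₁ ω, G₂ ω)) := by
  have hG := hG₁.prodMk hG₂
  have hZ : Measurable fun ω => f (Z' ω) := hf.comp hZ'
  have hindepZ : IndepFun (fun ω => (G₁ ω, G₂ ω)) (fun ω => (X ω, f (Z' ω))) μ :=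
    hindep.comp measurable_id (measurable_fst.prodMk (hf.comp measurable_snd))
  have hone := condEntropy_mixture (μ := μ) hX hZ hG hindepZ
    fun g x => if g.2 then x else 0
  have htwo := condEntropy_mixture (μ := μ) hX hZ' hG hindep
    fun g x => ((if g.1 then x else 0 : ZMod 2), (if g.2 then x else 0 : ZMod 2))
  have hreal : ∀ G : Ω → Bool, Measurable G → μ (G ⁻¹' {true}) = ENNReal.ofReal p →
      μ.real (G ⁻¹' {true}) = p ∧ μ.real (G ⁻¹' {false}) = 1 - p := by
    intro G hGm hB
    have htrue : μ.real (G ⁻¹' {true}) = p := by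
      rw [measureReal_def, hB, ENNReal.toReal_ofReal hp.1]
    have hsum := sum_measureReal_fiber_eq_one (μ := μ) hGm
    rw [Fintype.sum_bool, htrue] at hsum
    exact ⟨htrue, by linarith⟩
  obtain ⟨ht₁, hf₁⟩ := hreal G₁ hG₁ hBer₁
  obtain ⟨ht₂, hf₂⟩ := hreal G₂ hG₂ hBer₂
  have hpair : ∀ a b, μ.real ((fun ω => (G₁ ω, G₂ ω)) ⁻¹' {(a, b)})
      = μ.real (G₁ ⁻¹' {a}) * μ.real (G₂ ⁻¹' {b}) := by
    intro a b
    rw [← Set.singleton_prod_singleton, Set.mk_preimage_prod, measureReal_def,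
      hG₁G₂.measure_inter_preimage_eq_mul _ _ (measurableSet_singleton a)
        (measurableSet_singleton b), ENNReal.toReal_mul]
    rfl
  have hdiag : condEntropy μ (fun ω => (X ω, X ω)) Z' = condEntropy μ X Z' :=
    condEntropy_comp_injective hX hZ' (g := fun x => (x, x)) fun _ _ h => congrArg Prod.fst h
  have hleft : condEntropy μ (fun ω => (X ω, (0 : ZMod 2))) Z' = condEntropy μ X Z' :=
    condEntropy_comp_injective hX hZ' (g := fun x => (x, (0 : ZMod 2))) (Prod.mk_left_injective 0)
  have hright : condEntropy μ (fun ω => ((0 : ZMod 2), X ω)) Z' = condEntropy μ X Z' :=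
    condEntropy_comp_injective hX hZ' (g := fun x => ((0 : ZMod 2), x)) (Prod.mk_right_injective 0)
  simp only [Fintype.sum_prod_type, Fintype.sum_bool, hpair, ht₁, hf₁, ht₂, hf₂, if_true,
    Bool.false_eq_true, if_false, condEntropy_const hZ, condEntropy_const hZ', hdiag, hleft,
    hright] at hone htwo
  have hmono := condEntropy_le_condEntropy_comp (μ := μ) hX hZ' f
  change condEntropy μ (fun ω => (mask G₁ X ω, mask G₂ X ω)) (fun ω => (Z' ω, G₁ ω, G₂ ω))
    ≤ (2 - p) * condEntropy μ (mask G₂ X) (fun ω => (f (Z' ω), G₁ ω, G₂ ω))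
  calc _ = (2 - p) * p * condEntropy μ X Z' := htwo.trans (by ring)
    _ ≤ (2 - p) * p * condEntropy μ X (fun ω => f (Z' ω)) :=
      mul_le_mul_of_nonneg_left hmono (mul_nonneg (by linarith [hp.2]) hp.1)
    _ = _ := by
      rw [mul_assoc]
      exact congrArg ((2 - p) * ·) ((hone.trans (by ring)).symm)
end

section
/- (Single-letter output entropy bound used in the converse proofs.) Let G₁, G₂ : Ω → Bool be independent Bernoulli(p)-distributed random variables and X₁, X₂ : Ω → ZMod 2 measurable random variables on a probability space, and set Y := G₁·X₁ + G₂·X₂ in ZMod 2. Then H(Y | ⟨G₁, G₂⟩) ≤ (1 − (1−p)²) · log 2. -/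
open MeasureTheory ProbabilityTheory

/-- A two-point split of mass `a + b` increases `negMulLog` by at most `(a + b) * log 2`. -/
theorem negMulLog_add_negMulLog_le {a b : ℝ} (ha : 0 ≤ a) (hb : 0 ≤ b) :
    Real.negMulLog a + Real.negMulLog b ≤ Real.negMulLog (a + b) + (a + b) * Real.log 2 := by
  have h := Real.concaveOn_negMulLog.2 (Set.mem_Ici.2 ha) (Set.mem_Ici.2 hb)
    (by norm_num : (0 : ℝ) ≤ 1 / 2) (by norm_num : (0 : ℝ) ≤ 1 / 2) (by norm_num)
  have hmid : (1 / 2 : ℝ) • a + (1 / 2 : ℝ) • b = (a + b) * (1 / 2) := by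
    simp only [smul_eq_mul]; ring
  have hhalf : Real.negMulLog (1 / 2) = 1 / 2 * Real.log 2 := by
    simp [Real.negMulLog, Real.log_inv]
  rw [hmid, Real.negMulLog_mul, hhalf] at h
  simp only [smul_eq_mul] at h
  linarith

theorem measurable_mask {Ω : Type*} [MeasurableSpace Ω] {G : Ω → Bool} {X : Ω → ZMod 2}
    (hG : Measurable G) (hX : Measurable X) : Measurable (mask G X) :=
  Measurable.ite (hG (measurableSet_singleton true)) hX measurable_const

/-- Chain-rule form of conditional entropy as a sum over the values of the conditioning
variable. -/
theorem condEntropy_eq_sum {Ω : Type*} [MeasurableSpace Ω] (μ : Measure Ω)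
    {S T : Type*} [Fintype S] [Fintype T] (X : Ω → S) (Y : Ω → T) :
    condEntropy μ X Y = ∑ t : T,
      (∑ s : S, Real.negMulLog (μ.real (X ⁻¹' {s} ∩ Y ⁻¹' {t}))
        - Real.negMulLog (μ.real (Y ⁻¹' {t}))) := by
  have hpre : ∀ s t, (fun ω => (X ω, Y ω)) ⁻¹' {(s, t)} = X ⁻¹' {s} ∩ Y ⁻¹' {t} := by
    intro s t
    ext ω
    simp
  simp only [condEntropy, entropy, Fintype.sum_prod_type_right, hpre, Finset.sum_sub_distrib,
    Measure.real]

theorem measureReal_inter_zero_add_inter_one {Ω : Type*} [MeasurableSpace Ω] (μ : Measure Ω)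
    [IsFiniteMeasure μ] {Y : Ω → ZMod 2} (hY : Measurable Y) (A : Set Ω) :
    μ.real (Y ⁻¹' {0} ∩ A) + μ.real (Y ⁻¹' {1} ∩ A) = μ.real A := by
  have hdiff : Y ⁻¹' {1} ∩ A = A \ Y ⁻¹' {0} := by
    ext ω
    have hcases : ∀ y : ZMod 2, y = 1 ↔ y ≠ 0 := by decide
    simp [hcases, and_comm]
  rw [hdiff, Set.inter_comm]
  exact measureReal_inter_add_sdiff (hY (measurableSet_singleton 0))

/-- A `ZMod 2`-valued variable that vanishes where `T = t₀` has conditional entropy given `T`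
at most `μ(T ≠ t₀) * log 2`. -/
theorem condEntropy_le_of_eq_zero {Ω : Type*} [MeasurableSpace Ω] (μ : Measure Ω)
    [IsProbabilityMeasure μ] {T : Type*} [Fintype T] [MeasurableSpace T]
    [MeasurableSingletonClass T] {Y : Ω → ZMod 2} {Z : Ω → T} (hY : Measurable Y)
    (hZ : Measurable Z) (t₀ : T) (h : ∀ ω, Z ω = t₀ → Y ω = 0) :
    condEntropy μ Y Z ≤ (1 - μ.real (Z ⁻¹' {t₀})) * Real.log 2 := by
  classical
  have hsum (f : ZMod 2 → ℝ) : ∑ s, f s = f 0 + f 1 := Fin.sum_univ_two f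
  have htotal : ∑ t, μ.real (Z ⁻¹' {t}) = 1 := by
    rw [sum_measureReal_preimage_singleton _ fun t _ => hZ (measurableSet_singleton t)]
    simp
  have hzero : Y ⁻¹' {1} ∩ Z ⁻¹' {t₀} = ∅ := by
    ext ω
    simp only [Set.mem_inter_iff, Set.mem_preimage, Set.mem_singleton_iff,
      Set.mem_empty_iff_false, iff_false, not_and]
    intro hω hz
    simp [h ω hz] at hω
  rw [condEntropy_eq_sum]
  calc _ ≤ ∑ t, (if t = t₀ then 0 else μ.real (Z ⁻¹' {t})) * Real.log 2 := by
        refine Finset.sum_le_sum fun t _ => ?_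
        have hsplit := measureReal_inter_zero_add_inter_one μ hY (Z ⁻¹' {t})
        rw [hsum]
        split_ifs with ht
        · subst ht
          rw [hzero, measureReal_empty, add_zero] at hsplit
          simp [hzero, hsplit]
        · have := negMulLog_add_negMulLog_le (measureReal_nonneg (μ := μ)
            (s := Y ⁻¹' {0} ∩ Z ⁻¹' {t})) (measureReal_nonneg (μ := μ)
            (s := Y ⁻¹' {1} ∩ Z ⁻¹' {t}))
          rw [hsplit] at this
          linarith
    _ = (1 - μ.real (Z ⁻¹' {t₀})) * Real.log 2 := by
        rw [← Finset.sum_mul, ← htotal, ← Finset.add_sum_erase _ _ (Finset.mem_univ t₀),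
          ← Finset.add_sum_erase _ (fun t => μ.real (Z ⁻¹' {t})) (Finset.mem_univ t₀),
          if_pos rfl, zero_add, add_sub_cancel_left]
        congr 1
        exact Finset.sum_congr rfl fun t ht => if_neg (Finset.ne_of_mem_erase ht)

theorem measureReal_preimage_false {Ω : Type*} [MeasurableSpace Ω] (μ : Measure Ω)
    [IsProbabilityMeasure μ] {G : Ω → Bool} (hG : Measurable G) {p : ℝ} (hp : 0 ≤ p)
    (hBer : μ (G ⁻¹' {true}) = ENNReal.ofReal p) : μ.real (G ⁻¹' {false}) = 1 - p := by
  have hcompl : G ⁻¹' {false} = (G ⁻¹' {true})ᶜ := by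
    ext ω
    simp
  rw [hcompl, probReal_compl_eq_one_sub (hG (measurableSet_singleton true)), Measure.real, hBer,
    ENNReal.toReal_ofReal hp]

/-- **Single-letter output entropy bound.** If `G₁, G₂` are independent Bernoulli(`p`)
random variables and `Y = G₁·X₁ + G₂·X₂` in `ZMod 2`, then
`H(Y | ⟨G₁, G₂⟩) ≤ (1 − (1−p)²) · log 2`. -/
theorem stmt_17 {Ω : Type*} [MeasurableSpace Ω] (μ : Measure Ω) [IsProbabilityMeasure μ]
    (X₁ X₂ : Ω → ZMod 2) (G₁ G₂ : Ω → Bool) (p : ℝ)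
    (hX₁ : Measurable X₁) (hX₂ : Measurable X₂)
    (hG₁ : Measurable G₁) (hG₂ : Measurable G₂)
    (hp : p ∈ Set.Icc (0 : ℝ) 1)
    (hBer₁ : μ (G₁ ⁻¹' {true}) = ENNReal.ofReal p)
    (hBer₂ : μ (G₂ ⁻¹' {true}) = ENNReal.ofReal p)
    (hG₁G₂ : IndepFun G₁ G₂ μ) :
    condEntropy μ (fun ω => mask G₁ X₁ ω + mask G₂ X₂ ω) (fun ω => (G₁ ω, G₂ ω))
      ≤ (1 - (1 - p) ^ 2) * Real.log 2 := by
  have hzero (ω : Ω) (hω : (G₁ ω, G₂ ω) = (false, false)) :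
      mask G₁ X₁ ω + mask G₂ X₂ ω = 0 := by
    obtain ⟨h₁, h₂⟩ := Prod.mk.inj hω
    simp [mask, h₁, h₂]
  have hpre : (fun ω => (G₁ ω, G₂ ω)) ⁻¹' {(false, false)} =
      G₁ ⁻¹' {false} ∩ G₂ ⁻¹' {false} := by
    ext ω
    simp
  have hprob : μ.real ((fun ω => (G₁ ω, G₂ ω)) ⁻¹' {(false, false)}) = (1 - p) ^ 2 := by
    rw [hpre, Measure.real, hG₁G₂.measure_inter_preimage_eq_mul _ _ (measurableSet_singleton _)
      (measurableSet_singleton _), ENNReal.toReal_mul, ← Measure.real, ← Measure.real,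
      measureReal_preimage_false μ hG₁ hp.1 hBer₁, measureReal_preimage_false μ hG₂ hp.1 hBer₂, sq]
  rw [← hprob]
  exact condEntropy_le_of_eq_zero μ ((measurable_mask hG₁ hX₁).add (measurable_mask hG₂ hX₂))
    (hG₁.prodMk hG₂) (false, false) hzero
end
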